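/- There exist two trees T and T' on the same number n of vertices such that F₂(T) = F₂(T') while λ₁(T) ≠ λ₁(T'); consequently, for every σ > 0, d_{F₂}(T, T') = 0 < d_{λ₁}(T, T'), where d_I(G, H) = 1 − exp(−((I(G) − I(H))/σ)²). In particular, the conjectured inequality d_{F₂}(T, T') ≥ d_{λ₁}(T, T') for all trees T, T' on n vertices is false. -/

import Mathlib

open Classical in
/-- Adjacency matrix of a simple graph, with real entries. -/
noncomputable def adjMat {V : Type*} [Fintype V] (G : SimpleGraph V) : Matrix V V ℝ :=
  fun i j => if G.Adj i j then 1 else 0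

/-- Degree of a vertex, as a real number (row sum of the adjacency matrix). -/
noncomputable def degRe {V : Type*} [Fintype V] (G : SimpleGraph V) (v : V) : ℝ :=
  ∑ j, adjMat G v j

/-- Laplacian matrix `L(G) = D(G) - A(G)`. -/
noncomputable def lapMat {V : Type*} [Fintype V] [DecidableEq V] (G : SimpleGraph V) :
    Matrix V V ℝ :=
  Matrix.diagonal (degRe G) - adjMat G

/-- Largest eigenvalue of the adjacency matrix (which is real symmetric, so its spectrum is a
nonempty finite set of reals). -/
noncomputable def lam1 {V : Type*} [Fintype V] [DecidableEq V] (G : SimpleGraph V) : ℝ :=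
  sSup (spectrum ℝ (adjMat G))

/-- Largest eigenvalue of the Laplacian matrix. -/
noncomputable def q1 {V : Type*} [Fintype V] [DecidableEq V] (G : SimpleGraph V) : ℝ :=
  sSup (spectrum ℝ (lapMat G))

/-- Sum of squared vertex degrees (the second degree power / zeroth Randić index). -/
noncomputable def F2 {V : Type*} [Fintype V] (G : SimpleGraph V) : ℝ :=
  ∑ v, (degRe G v) ^ 2

/-- The graph distance measure `d_I(G,H) = 1 - exp(-((I(G)-I(H))/σ)^2)`, as a function of the
parameter `σ` and the two invariant values `x = I(G)` and `y = I(H)`. -/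
noncomputable def dMeasure (σ x y : ℝ) : ℝ :=
  1 - Real.exp (-(((x - y) / σ) ^ 2))

/-- The spider on six vertices with legs of lengths 1, 1, 3 and centre 0. -/
def spider113 : SimpleGraph (Fin 6) :=
  SimpleGraph.fromRel fun i j => (i, j) ∈ [(0, 1), (0, 2), (0, 3), (3, 4), (4, 5)]

/-- The spider on six vertices with legs of lengths 1, 2, 2 and centre 0. -/
def spider122 : SimpleGraph (Fin 6) :=
  SimpleGraph.fromRel fun i j => (i, j) ∈ [(0, 1), (0, 2), (0, 3), (2, 4), (3, 5)]

instance : DecidableRel spider113.Adj := fun i j =>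
  decidable_of_iff _ (SimpleGraph.fromRel_adj _ i j).symm

instance : DecidableRel spider122.Adj := fun i j =>
  decidable_of_iff _ (SimpleGraph.fromRel_adj _ i j).symm

lemma isTree_spider113 : spider113.IsTree := by
  rw [SimpleGraph.isTree_iff_connected_and_card]
  refine ⟨by decide, ?_⟩
  rw [Nat.card_eq_fintype_card, Nat.card_eq_fintype_card]
  decide

lemma isTree_spider122 : spider122.IsTree := by
  rw [SimpleGraph.isTree_iff_connected_and_card]
  refine ⟨by decide, ?_⟩
  rw [Nat.card_eq_fintype_card, Nat.card_eq_fintype_card]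
  decide

lemma adjMat_spider113 : adjMat spider113 =
    !![0, 1, 1, 1, 0, 0;
       1, 0, 0, 0, 0, 0;
       1, 0, 0, 0, 0, 0;
       1, 0, 0, 0, 1, 0;
       0, 0, 0, 1, 0, 1;
       0, 0, 0, 0, 1, 0] := by
  ext i j
  fin_cases i <;> fin_cases j <;> simp [adjMat, spider113]

lemma adjMat_spider122 : adjMat spider122 =
    !![0, 1, 1, 1, 0, 0;
       1, 0, 0, 0, 0, 0;
       1, 0, 0, 0, 1, 0;
       1, 0, 0, 0, 0, 1;
       0, 0, 1, 0, 0, 0;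
       0, 0, 0, 1, 0, 0] := by
  ext i j
  fin_cases i <;> fin_cases j <;> simp [adjMat, spider122]

lemma F2_spider113 : F2 spider113 = 20 := by
  simp only [F2, degRe, adjMat_spider113, Fin.sum_univ_six]
  simp
  norm_num

lemma F2_spider122 : F2 spider122 = 20 := by
  simp only [F2, degRe, adjMat_spider122, Fin.sum_univ_six]
  simp
  norm_num

open Matrix in
lemma Matrix.mem_spectrum_iff_exists_mulVec {K n : Type*} [Field K] [Fintype n] [DecidableEq n]
    {A : Matrix n n K} {μ : K} : μ ∈ spectrum K A ↔ ∃ v ≠ 0, A *ᵥ v = μ • v := by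
  rw [← Matrix.spectrum_toLin', ← Module.End.hasEigenvalue_iff_mem_spectrum]
  constructor
  · intro h
    obtain ⟨v, hv⟩ := h.exists_hasEigenvector
    exact ⟨v, hv.2, by simpa using hv.apply_eq_smul⟩
  · rintro ⟨v, hv, h⟩
    exact Module.End.hasEigenvalue_of_hasEigenvector
      (Module.End.hasEigenvector_iff.2 ⟨Module.End.mem_eigenspace_iff.2 (by simpa using h), hv⟩)

lemma sq_le_of_mem_spectrum_spider113 {μ : ℝ} (hμ : μ ∈ spectrum ℝ (adjMat spider113)) :
    μ ^ 2 ≤ 3.7 := by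
  obtain ⟨v, hv, h⟩ := Matrix.mem_spectrum_iff_exists_mulVec.1 hμ
  rw [adjMat_spider113, funext_iff] at h
  simp [Fin.forall_fin_succ, Matrix.mulVec, dotProduct, Fin.sum_univ_six] at h
  obtain ⟨h0, h1, h2, h3, h4, h5⟩ := h
  by_contra! hlt
  have hμ0 : μ ≠ 0 := by rintro rfl; norm_num at hlt
  have key : μ * ((μ ^ 2) ^ 2 - 5 * μ ^ 2 + 5) * v 5 = 0 := by
    have e3 : v 3 = (μ ^ 2 - 1) * v 5 := by linear_combination h4 + μ * h5
    have e0 : v 0 = (μ ^ 3 - 2 * μ) * v 5 := by linear_combination h3 - h5 + μ * e3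
    linear_combination -(μ ^ 2 - 2) * e0 + μ * e3 - μ * h0 - h1 - h2
  have hpos : (μ ^ 2) ^ 2 - 5 * μ ^ 2 + 5 ≠ 0 := by nlinarith
  have e5 : v 5 = 0 := by simpa [hμ0, hpos] using key
  have e4 : v 4 = 0 := by simpa [e5] using h5
  have e3 : v 3 = 0 := by simpa [e4, e5] using h4
  have e0 : v 0 = 0 := by simpa [e3, e4] using h3
  have e1 : v 1 = 0 := by simpa [e0, hμ0] using h1
  have e2 : v 2 = 0 := by simpa [e0, hμ0] using h2
  exact hv (by ext i; fin_cases i <;> assumption)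

lemma lam1_spider113_le : lam1 spider113 ≤ √3.7 :=
  Real.sSup_le (fun _ h => Real.le_sqrt_of_sq_le (sq_le_of_mem_spectrum_spider113 h))
    (Real.sqrt_nonneg _)

lemma sqrt_mem_spectrum_spider122 : √(2 + √3) ∈ spectrum ℝ (adjMat spider122) := by
  rw [Matrix.mem_spectrum_iff_exists_mulVec]
  have h3 : √3 ^ 2 = (3 : ℝ) := Real.sq_sqrt (by norm_num)
  have hμ : √(2 + √3) ^ 2 = 2 + √3 := Real.sq_sqrt (by positivity)
  set μ := √(2 + √3)
  have hq : μ ^ 4 = 4 * μ ^ 2 - 1 := by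
    linear_combination (μ ^ 2 + √3 - 2) * hμ + h3
  refine ⟨![μ ^ 2 - 1, μ ^ 3 - 3 * μ, μ, μ, 1, 1], fun h => ?_, ?_⟩
  · simpa using congrFun h 4
  · rw [adjMat_spider122]
    ext i
    fin_cases i <;> simp [Matrix.mulVec, dotProduct, Fin.sum_univ_six] <;>
      first | ring1 | linear_combination -hq

lemma le_lam1_spider122 : √(2 + √3) ≤ lam1 spider122 :=
  le_csSup (Matrix.finite_spectrum _).bddAbove sqrt_mem_spectrum_spider122

lemma lam1_spider113_lt_lam1_spider122 : lam1 spider113 < lam1 spider122 := by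
  refine lam1_spider113_le.trans_lt (lt_of_lt_of_le ?_ le_lam1_spider122)
  have : (1.7 : ℝ) < √3 := Real.lt_sqrt_of_sq_lt (by norm_num)
  exact Real.sqrt_lt_sqrt (by norm_num) (by linarith)

lemma dMeasure_self (σ x : ℝ) : dMeasure σ x x = 0 := by simp [dMeasure]

lemma dMeasure_pos {σ x y : ℝ} (hσ : σ ≠ 0) (hxy : x ≠ y) : 0 < dMeasure σ x y := by
  have : (x - y) / σ ≠ 0 := div_ne_zero (sub_ne_zero.2 hxy) hσ
  simpa [dMeasure] using sq_pos_of_ne_zero this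

/-- There exist two trees on the same number `n` of vertices with
`F₂(T) = F₂(T')` but `λ₁(T) ≠ λ₁(T')`, so that `d_{F₂}(T,T') = 0 < d_{λ₁}(T,T')` for every
`σ > 0`; in particular the conjectured inequality `d_{F₂}(T,T') ≥ d_{λ₁}(T,T')` for all trees
on `n` vertices is false. -/
theorem exists_trees_same_F2_different_lam1 :
    (∃ (n : ℕ) (T T' : SimpleGraph (Fin n)), T.IsTree ∧ T'.IsTree ∧
      F2 T = F2 T' ∧ lam1 T ≠ lam1 T' ∧
      ∀ σ : ℝ, 0 < σ →
        dMeasure σ (F2 T) (F2 T') = 0 ∧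
        dMeasure σ (F2 T) (F2 T') < dMeasure σ (lam1 T) (lam1 T')) ∧
    ¬ (∀ (n : ℕ) (T T' : SimpleGraph (Fin n)), T.IsTree → T'.IsTree →
        ∀ σ : ℝ, 0 < σ → dMeasure σ (F2 T) (F2 T') ≥ dMeasure σ (lam1 T) (lam1 T')) := by
  have hF : F2 spider113 = F2 spider122 := F2_spider113.trans F2_spider122.symm
  have hlam : lam1 spider113 ≠ lam1 spider122 := lam1_spider113_lt_lam1_spider122.ne
  have hd (σ : ℝ) (hσ : 0 < σ) : dMeasure σ (F2 spider113) (F2 spider122) = 0 ∧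
      dMeasure σ (F2 spider113) (F2 spider122) <
        dMeasure σ (lam1 spider113) (lam1 spider122) := by
    rw [hF, dMeasure_self]
    exact ⟨rfl, dMeasure_pos hσ.ne' hlam⟩
  refine ⟨⟨6, spider113, spider122, isTree_spider113, isTree_spider122, hF, hlam, hd⟩, fun h => ?_⟩
  exact (hd 1 one_pos).2.not_ge (h 6 _ _ isTree_spider113 isTree_spider122 1 one_pos)
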